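/- Let n = 2f with f ≥ 1. Then in A one has Ê_f · (Σ_{w ∈ 𝔻_{(1,f−1)}·H_f(2f)} q^{ℓ(w)} T_w) = (Σ_{k=0}^{f−1} q^{2k}) · Ê_f · Ĥ_f, where Ĥ_f = Σ_{d∈H_f(2f)} q^{ℓ(d)} T_d. -/

import Mathlib

open Finset
open scoped Pointwise

namespace BMWPaper

/-- The Coxeter length of a permutation of `Fin n`: the number of inversions. -/
def len {n : ℕ} (w : Equiv.Perm (Fin n)) : ℕ :=
  (Finset.univ.filter (fun p : Fin n × Fin n => p.1 < p.2 ∧ w p.2 < w p.1)).card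

/-- `sGen n i` is the adjacent transposition `s_i = (i, i+1)` (1-based) in `S_n`;
it is the identity for out-of-range `i`. -/
def sGen (n i : ℕ) : Equiv.Perm (Fin n) :=
  if h : 1 ≤ i ∧ i < n then Equiv.swap ⟨i - 1, by omega⟩ ⟨i, h.2⟩ else 1

/-- `pimg d i` is the (1-based) image `(i)d` of the point `i ∈ {1,…,n}` under the
*right* action of the permutation `d` (permutations act on points on the right,
so that `(a)(στ) = ((a)σ)τ` for the group multiplication `σ * τ`);
the junk value `0` is returned for out-of-range `i`. -/
def pimg {n : ℕ} (d : Equiv.Perm (Fin n)) (i : ℕ) : ℕ :=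
  if h : i - 1 < n then ((d⁻¹ ⟨i - 1, h⟩ : Fin n) : ℕ) + 1 else 0

open scoped Classical in
/-- `Hset n f` is the set `H_f(n)` of all `d ∈ S_n` such that
`(1)d < (3)d < ⋯ < (2f-1)d`, `(2i-1)d < (2i)d` for `i = 1,…,f`, and
`(2f+1)d < (2f+2)d < ⋯ < (n)d`. -/
noncomputable def Hset (n f : ℕ) : Finset (Equiv.Perm (Fin n)) :=
  Finset.univ.filter (fun d =>
    (∀ i ∈ Finset.Icc 1 (f - 1), pimg d (2 * i - 1) < pimg d (2 * i + 1)) ∧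
    (∀ i ∈ Finset.Icc 1 f, pimg d (2 * i - 1) < pimg d (2 * i)) ∧
    (∀ j ∈ Finset.Icc (2 * f + 1) (n - 1), pimg d j < pimg d (j + 1)))

/-- The index of the block of the composition `μ` containing the (0-based) point `k`. -/
def blockOf (μ : List ℕ) (k : ℕ) : ℕ :=
  ((List.range μ.length).filter (fun j => (μ.take (j + 1)).sum ≤ k)).length

open scoped Classical in
/-- The Young subgroup `S_μ` of `S_n` associated with a composition `μ` of `n`,
as the set of permutations preserving each of the consecutive blocks of `μ`. -/
noncomputable def youngSet (n : ℕ) (μ : List ℕ) : Finset (Equiv.Perm (Fin n)) :=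
  Finset.univ.filter (fun w => ∀ a : Fin n, blockOf μ ((w a : ℕ)) = blockOf μ (a : ℕ))

open scoped Classical in
/-- The set `D_μ` of minimal-length right coset representatives of `S_μ` in `S_n`:
the elements of minimal length in their right coset `S_μ d`. -/
noncomputable def Dset (n : ℕ) (μ : List ℕ) : Finset (Equiv.Perm (Fin n)) :=
  Finset.univ.filter (fun d => ∀ u ∈ youngSet n μ, len d ≤ len (u * d))

/-- The identification of `Fin m` with the block `[k, k+m)` of `Fin n` (0-based). -/
def shiftEquiv (n k m : ℕ) (h : k + m ≤ n) :
    Fin m ≃ {a : Fin n // k ≤ (a : ℕ) ∧ (a : ℕ) < k + m} where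
  toFun b := ⟨⟨k + (b : ℕ), by have := b.isLt; omega⟩, by
    constructor
    · exact Nat.le_add_right _ _
    · have := b.isLt; simp only [Fin.val_mk]; omega⟩
  invFun a := ⟨(a : Fin n) - k, by have := a.2; omega⟩
  left_inv b := by
    apply Fin.ext
    simp
  right_inv a := by
    apply Subtype.ext
    apply Fin.ext
    have := a.2
    simp only []
    omega

open scoped Classical in
/-- The embedding of `S_m` into `S_n` as the group of permutations of the
(1-based) block `{k+1, …, k+m}` of `{1, …, n}`. -/
noncomputable def shiftEmb (n k m : ℕ) (w : Equiv.Perm (Fin m)) : Equiv.Perm (Fin n) :=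
  if h : k + m ≤ n then w.extendDomain (shiftEquiv n k m h) else 1

open scoped Classical in
/-- The subgroup of `S_n` of permutations fixing the (1-based) points `1, …, k`. -/
noncomputable def fixSet (n k : ℕ) : Finset (Equiv.Perm (Fin n)) :=
  Finset.univ.filter (fun w => ∀ a : Fin n, (a : ℕ) < k → w a = a)


/-- `bbs n i` is the permutation `𝕤_i = s_{2i} s_{2i-1} s_{2i+1} s_{2i} = (2i-1, 2i+1)(2i, 2i+2)`. -/
def bbs (n i : ℕ) : Equiv.Perm (Fin n) :=
  sGen n (2 * i) * sGen n (2 * i - 1) * sGen n (2 * i + 1) * sGen n (2 * i)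

open scoped Classical in
/-- The set `𝔻_{(1,f-1)} = {𝕤_1 𝕤_2 ⋯ 𝕤_k : k = 0, …, f-1}` in `S_{2f}`. -/
noncomputable def bbD1 (f : ℕ) : Finset (Equiv.Perm (Fin (2 * f))) :=
  (Finset.range f).image (fun k => ((List.range k).map (fun j => bbs (2 * f) (j + 1))).prod)

open scoped Classical in
/-- The set `𝔻_{(1,f-2)}^{{2,…,f}} = {𝕤_2 𝕤_3 ⋯ 𝕤_k : k = 1, …, f-1}` in `S_{2f}`. -/
noncomputable def bbD1' (f : ℕ) : Finset (Equiv.Perm (Fin (2 * f))) :=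
  (Finset.Icc 1 (f - 1)).image
    (fun k => ((List.range (k - 1)).map (fun j => bbs (2 * f) (j + 2))).prod)

open scoped Classical in
/-- `H_f^{(a)} = {d ∈ H_f(n) : (1)d⁻¹ = 1, (2)d⁻¹ = 2}`. -/
noncomputable def HsetA (n f : ℕ) : Finset (Equiv.Perm (Fin n)) :=
  (Hset n f).filter (fun d => pimg d⁻¹ 1 = 1 ∧ pimg d⁻¹ 2 = 2)

open scoped Classical in
/-- `H_f^{(b)} = {d ∈ H_f(n) : (1)d⁻¹ = 1, (2)d⁻¹ = 3}`. -/
noncomputable def HsetB (n f : ℕ) : Finset (Equiv.Perm (Fin n)) :=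
  (Hset n f).filter (fun d => pimg d⁻¹ 1 = 1 ∧ pimg d⁻¹ 2 = 3)

open scoped Classical in
/-- `H_f^{(c)} = {d ∈ H_f(n) : (1)d⁻¹ = 1, (2)d⁻¹ = 2f+1}`. -/
noncomputable def HsetC (n f : ℕ) : Finset (Equiv.Perm (Fin n)) :=
  (Hset n f).filter (fun d => pimg d⁻¹ 1 = 1 ∧ pimg d⁻¹ 2 = 2 * f + 1)

open scoped Classical in
/-- `H_f^{(d)} = {d ∈ H_f(n) : (1)d⁻¹ = 2f+1, (2)d⁻¹ = 1}`. -/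
noncomputable def HsetD (n f : ℕ) : Finset (Equiv.Perm (Fin n)) :=
  (Hset n f).filter (fun d => pimg d⁻¹ 1 = 2 * f + 1 ∧ pimg d⁻¹ 2 = 1)

open scoped Classical in
/-- `H_f^{(e)} = {d ∈ H_f(n) : (1)d⁻¹ = 2f+1, (2)d⁻¹ = 2f+2}`. -/
noncomputable def HsetE (n f : ℕ) : Finset (Equiv.Perm (Fin n)) :=
  (Hset n f).filter (fun d => pimg d⁻¹ 1 = 2 * f + 1 ∧ pimg d⁻¹ 2 = 2 * f + 2)

section Algebra

variable {F : Type*} [Field F] {A : Type*} [Ring A] [Algebra F A]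

/-- For a set `S` of permutations, `hat c Tw S = Σ_{w ∈ S} c^{ℓ(w)} T_w`. -/
noncomputable def hat {n : ℕ} (c : F) (Tw : Equiv.Perm (Fin n) → A)
    (S : Finset (Equiv.Perm (Fin n))) : A :=
  ∑ w ∈ S, c ^ len w • Tw w

/-- `Ehat E f = E_1 E_3 ⋯ E_{2f-1}`. -/
def Ehat (E : ℕ → A) (f : ℕ) : A := ((List.range f).map (fun i => E (2 * i + 1))).prod

/-- `Tprod T a b = T_a T_{a+1} ⋯ T_b` (the empty product `1` if `b < a`). -/
def Tprod (T : ℕ → A) (a b : ℕ) : A := ((List.range (b + 1 - a)).map (fun t => T (a + t))).prod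

/-- `sDesc n a b = s_a s_{a-1} ⋯ s_b` (descending product of adjacent transpositions). -/
def sDesc (n a b : ℕ) : Equiv.Perm (Fin n) :=
  ((List.range (a + 1 - b)).map (fun j => sGen n (a - j))).prod

/-- The data of a Birman–Murakami–Wenzl algebra structure: an `F`-algebra `A`
with invertible elements `T_1, …, T_{n-1}` and elements `E_1, …, E_{n-1}`
satisfying the BMW relations, together with a map `w ↦ T_w` from `S_n` to `A`
with `T_id = 1`, `T_{s_i} = T_i` and `T_{uv} = T_u T_v` whenever lengths add. -/
structure BMWData (F : Type*) [Field F] (A : Type*) [Ring A] [Algebra F A]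
    (n : ℕ) (q r : F) where
  T : ℕ → A
  Tinv : ℕ → A
  E : ℕ → A
  Tw : Equiv.Perm (Fin n) → A
  hq : q ≠ 0
  hr : r ≠ 0
  hqq : q - q⁻¹ ≠ 0
  T_mul_Tinv : ∀ i, 1 ≤ i → i ≤ n - 1 → T i * Tinv i = 1
  Tinv_mul_T : ∀ i, 1 ≤ i → i ≤ n - 1 → Tinv i * T i = 1
  skein : ∀ i, 1 ≤ i → i ≤ n - 1 → T i - Tinv i = (q - q⁻¹) • (1 - E i)
  Esq : ∀ i, 1 ≤ i → i ≤ n - 1 → E i * E i = (1 + (r - r⁻¹) / (q - q⁻¹)) • E i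
  braid : ∀ i, 1 ≤ i → i + 1 ≤ n - 1 → T i * T (i + 1) * T i = T (i + 1) * T i * T (i + 1)
  T_comm : ∀ i j, 1 ≤ i → i ≤ n - 1 → 1 ≤ j → j ≤ n - 1 → (i + 1 < j ∨ j + 1 < i) →
    T i * T j = T j * T i
  EEE₁ : ∀ i, 1 ≤ i → i + 1 ≤ n - 1 → E i * E (i + 1) * E i = E i
  EEE₂ : ∀ i, 1 ≤ i → i + 1 ≤ n - 1 → E (i + 1) * E i * E (i + 1) = E (i + 1)
  TTE₁ : ∀ i, 1 ≤ i → i + 1 ≤ n - 1 → T i * T (i + 1) * E i = E (i + 1) * E i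
  TTE₂ : ∀ i, 1 ≤ i → i + 1 ≤ n - 1 → T (i + 1) * T i * E (i + 1) = E i * E (i + 1)
  ET : ∀ i, 1 ≤ i → i ≤ n - 1 → E i * T i = r⁻¹ • E i
  TE : ∀ i, 1 ≤ i → i ≤ n - 1 → T i * E i = r⁻¹ • E i
  ETE₁ : ∀ i, 1 ≤ i → i + 1 ≤ n - 1 → E i * T (i + 1) * E i = r • E i
  ETE₂ : ∀ i, 1 ≤ i → i + 1 ≤ n - 1 → E (i + 1) * T i * E (i + 1) = r • E (i + 1)
  Tw_one : Tw 1 = 1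
  Tw_s : ∀ i, 1 ≤ i → i ≤ n - 1 → Tw (sGen n i) = T i
  Tw_mul : ∀ u v : Equiv.Perm (Fin n), len (u * v) = len u + len v →
    Tw (u * v) = Tw u * Tw v

/-- The scalars `a_f` defined by `a_0 = 1` and `a_i = a_{i-1} · Σ_{k=0}^{i-1} q^{2k}`. -/
noncomputable def aseq (q : F) : ℕ → F
  | 0 => 1
  | (i + 1) => aseq q i * (∑ k ∈ Finset.range (i + 1), q ^ (2 * k))


/-- The scalars `c_f` defined by `c_0 = 1` and
`c_f = -((q^{4f-3} - q^{2f-3})/(r q^{2n-2f-2} - q⁻¹)) · c_{f-1}`. -/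
noncomputable def cseq (q r : F) (n : ℕ) : ℕ → F
  | 0 => 1
  | (f + 1) =>
      -((q ^ (4 * ((f : ℤ) + 1) - 3) - q ^ (2 * ((f : ℤ) + 1) - 3)) /
          (r * q ^ (2 * (n : ℤ) - 2 * ((f : ℤ) + 1) - 2) - q⁻¹)) * cseq q r n f

/-- The scalars `č_f` defined by `č_0 = 1` and
`č_f = (q^{3-4f}(1 - q^{2f})/(q + r q^{2+2f-2n})) · č_{f-1}` (with integer exponents). -/
noncomputable def ccseq (q r : F) (n : ℕ) : ℕ → F
  | 0 => 1
  | (f + 1) =>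
      (q ^ ((3 : ℤ) - 4 * ((f : ℤ) + 1)) * (1 - q ^ (2 * (f + 1))) /
          (q + r * q ^ ((2 : ℤ) + 2 * ((f : ℤ) + 1) - 2 * (n : ℤ)))) * ccseq q r n f

/-- The element `x_f = (H_f⁻¹)^ · Ŝ_{{2f+1,…,n}} · Ê_f · Ĥ_f` of the BMW algebra. -/
noncomputable def xEl {F : Type*} [Field F] {A : Type*} [Ring A] [Algebra F A]
    {n : ℕ} {q r : F} (D : BMWData F A n q r) (f : ℕ) : A :=
  hat q D.Tw ((Hset n f).image (fun d => d⁻¹)) * hat q D.Tw (fixSet n (2 * f)) *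
    Ehat D.E f * hat q D.Tw (Hset n f)

/-- The element `x̌_f = (H_f⁻¹)ˇ · Š_{{2f+1,…,n}} · Ê_f · Ȟ_f` of the BMW algebra,
where `ˇ` is formed with `-q⁻¹` in place of `q`. -/
noncomputable def xElCheck {F : Type*} [Field F] {A : Type*} [Ring A] [Algebra F A]
    {n : ℕ} {q r : F} (D : BMWData F A n q r) (f : ℕ) : A :=
  hat (-q⁻¹) D.Tw ((Hset n f).image (fun d => d⁻¹)) * hat (-q⁻¹) D.Tw (fixSet n (2 * f)) *
    Ehat D.E f * hat (-q⁻¹) D.Tw (Hset n f)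

end Algebra

section Permutations

lemma pimg_lt_iff {n : ℕ} (w : Equiv.Perm (Fin n)) {i j : ℕ} (hi : i - 1 < n) (hj : j - 1 < n) :
    pimg w i < pimg w j ↔ w⁻¹ ⟨i - 1, hi⟩ < w⁻¹ ⟨j - 1, hj⟩ := by
  simp only [pimg, hi, hj, dif_pos, Fin.lt_def]
  omega

lemma pimg_ne {n : ℕ} (w : Equiv.Perm (Fin n)) {i j : ℕ} (hi : 1 ≤ i) (hin : i ≤ n)
    (hj : 1 ≤ j) (hjn : j ≤ n) (hij : i ≠ j) : pimg w i ≠ pimg w j := by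
  have hi' : i - 1 < n := by omega
  have hj' : j - 1 < n := by omega
  simp only [pimg, hi', hj', dif_pos]
  intro h
  have h2 : w⁻¹ ⟨i - 1, hi'⟩ = w⁻¹ ⟨j - 1, hj'⟩ := Fin.ext (by omega)
  have h3 := congrArg Fin.val (w⁻¹.injective h2)
  simp only at h3
  omega

lemma sGen_mul_self (n i : ℕ) : sGen n i * sGen n i = 1 := by
  unfold sGen
  split_ifs
  · exact Equiv.swap_mul_self _ _
  · simp

lemma sGen_mul_cancel {n : ℕ} (i : ℕ) (w : Equiv.Perm (Fin n)) :
    sGen n i * (sGen n i * w) = w := by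
  rw [← mul_assoc, sGen_mul_self, one_mul]

/-- Left multiplication by `s_i` exchanges the images of `i` and `i + 1`. -/
lemma pimg_sGen_mul {n i : ℕ} (hi : 1 ≤ i) (hin : i < n) (w : Equiv.Perm (Fin n)) {k : ℕ}
    (hk : 1 ≤ k) :
    pimg (sGen n i * w) k = pimg w (if k = i then i + 1 else if k = i + 1 then i else k) := by
  have hs : (sGen n i)⁻¹ = Equiv.swap ⟨i - 1, by omega⟩ ⟨i, hin⟩ := by
    simp [sGen, hi, hin]
  unfold pimg
  by_cases hkn : k - 1 < n
  · simp only [mul_inv_rev, hs, Equiv.Perm.mul_apply, hkn, dif_pos]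
    split_ifs with h1 h2 h3 h4
    · subst h1
      simp
    · omega
    · subst h3
      simp
    · omega
    · rw [Equiv.swap_apply_of_ne_of_ne]
      · simp only [ne_eq, Fin.mk.injEq]; omega
      · simp only [ne_eq, Fin.mk.injEq]; omega
  · rw [dif_neg hkn, dif_neg]
    split_ifs <;> omega

lemma len_one (n : ℕ) : len (1 : Equiv.Perm (Fin n)) = 0 := by
  simp only [len, Finset.card_eq_zero, Finset.filter_eq_empty_iff]
  rintro ⟨a, b⟩ -
  simp only [Equiv.Perm.one_apply]
  exact fun h => lt_asymm h.1 h.2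

lemma len_sGen_mul {n i : ℕ} (hi : 1 ≤ i) (hin : i < n) (w : Equiv.Perm (Fin n))
    (h : pimg w i < pimg w (i + 1)) : len (sGen n i * w) = len w + 1 := by
  have hi' : i - 1 < n := by omega
  rw [pimg_lt_iff w hi' (by omega)] at h
  simp only [Nat.add_sub_cancel] at h
  have hs : sGen n i = Equiv.swap ⟨i - 1, hi'⟩ ⟨i, hin⟩ := by simp [sGen, hi, hin]
  have hw : ∀ x, w (w⁻¹ x) = x := w.apply_symm_apply
  unfold len
  rw [← Finset.card_insert_of_notMem (a := (w⁻¹ ⟨i - 1, hi'⟩, w⁻¹ ⟨i, hin⟩))]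
  · congr 1
    ext ⟨a, b⟩
    obtain ⟨x, rfl⟩ := w⁻¹.surjective a
    obtain ⟨y, rfl⟩ := w⁻¹.surjective b
    simp only [Finset.mem_insert, Finset.mem_filter, Finset.mem_univ, true_and, Prod.mk.injEq,
      EmbeddingLike.apply_eq_iff_eq, Equiv.Perm.mul_apply, hw, hs,
      Equiv.swap_apply_def, Fin.ext_iff]
    have hxy : (x : ℕ) = y → ¬ w⁻¹ x < w⁻¹ y := by
      intro e
      rw [Fin.ext e]
      exact lt_irrefl _
    have hasymm : (x : ℕ) = i → (y : ℕ) = i - 1 → ¬ w⁻¹ x < w⁻¹ y := by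
      intro e₁ e₂ hlt
      have e₁' : x = ⟨i, hin⟩ := Fin.ext e₁
      have e₂' : y = ⟨i - 1, hi'⟩ := Fin.ext e₂
      subst e₁' e₂'
      exact lt_asymm h hlt
    have hsame : (x : ℕ) = i - 1 → (y : ℕ) = i → w⁻¹ x < w⁻¹ y := by
      intro e₁ e₂
      have e₁' : x = ⟨i - 1, hi'⟩ := Fin.ext e₁
      have e₂' : y = ⟨i, hin⟩ := Fin.ext e₂
      subst e₁' e₂'
      exact h
    by_cases hP : w⁻¹ x < w⁻¹ y <;>
      simp only [hP, not_true_eq_false, not_false_eq_true, imp_false, Fin.lt_def, true_and,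
        false_and, or_false] at hxy hasymm hsame ⊢ <;>
      grind
  · simp only [Finset.mem_filter, Finset.mem_univ, true_and, hw, not_and,
      Fin.lt_def]
    omega

lemma len_sGen {n i : ℕ} (hi : 1 ≤ i) (hin : i < n) : len (sGen n i) = 1 := by
  have h := len_sGen_mul hi hin 1 (by
    rw [pimg_lt_iff _ (by omega) (by omega)]
    simp only [inv_one, Equiv.Perm.one_apply, Fin.mk_lt_mk]
    omega)
  rwa [mul_one, len_one] at h

lemma bbs_mul (n i : ℕ) (w : Equiv.Perm (Fin n)) :
    bbs n i * w = sGen n (2 * i) * (sGen n (2 * i - 1) *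
      (sGen n (2 * i + 1) * (sGen n (2 * i) * w))) := by
  simp only [bbs, mul_assoc]

/-- Left multiplication by `𝕤_i` exchanges the `i`-th and `(i+1)`-st pairs of images. -/
lemma pimg_bbs_mul {f i : ℕ} (hi : 1 ≤ i) (hif : i < f) (w : Equiv.Perm (Fin (2 * f))) {k : ℕ}
    (hk : 1 ≤ k) :
    pimg (bbs (2 * f) i * w) k = pimg w (if k = 2 * i - 1 then 2 * i + 1 else
      if k = 2 * i then 2 * i + 2 else if k = 2 * i + 1 then 2 * i - 1 else
      if k = 2 * i + 2 then 2 * i else k) := by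
  rw [bbs_mul, pimg_sGen_mul (by omega) (by omega) _ hk,
    pimg_sGen_mul (by omega) (by omega) _ (by split_ifs <;> omega),
    pimg_sGen_mul (by omega) (by omega) _ (by split_ifs <;> omega),
    pimg_sGen_mul (by omega) (by omega) _ (by split_ifs <;> omega)]
  congr 1
  split_ifs <;> omega

lemma bbs_mul_cancel {f i : ℕ} (hi : 1 ≤ i) (hif : i < f) (w : Equiv.Perm (Fin (2 * f))) :
    bbs (2 * f) i * (bbs (2 * f) i * w) = w := by
  apply inv_injective
  ext k
  have h : pimg (bbs (2 * f) i * (bbs (2 * f) i * w)) (k + 1) = pimg w (k + 1) := by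
    rw [pimg_bbs_mul hi hif _ (by omega), pimg_bbs_mul hi hif _ (by split_ifs <;> omega)]
    congr 1
    split_ifs <;> omega
  simpa [pimg] using h

open scoped Classical in
/-- The permutations `d ∈ S_{2f}` with `(2k-1)d < (2k)d` for all `k` and `(2k-1)d < (2l-1)d` for
all `k < l` with `k ≠ i`. -/
noncomputable def almostSorted (f i : ℕ) : Finset (Equiv.Perm (Fin (2 * f))) :=
  Finset.univ.filter (fun d =>
    (∀ k, 1 ≤ k → k ≤ f → pimg d (2 * k - 1) < pimg d (2 * k)) ∧
    (∀ k l, 1 ≤ k → k < l → l ≤ f → k ≠ i → pimg d (2 * k - 1) < pimg d (2 * l - 1)))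

lemma mem_almostSorted {f i : ℕ} {d : Equiv.Perm (Fin (2 * f))} :
    d ∈ almostSorted f i ↔
      (∀ k, 1 ≤ k → k ≤ f → pimg d (2 * k - 1) < pimg d (2 * k)) ∧
      (∀ k l, 1 ≤ k → k < l → l ≤ f → k ≠ i → pimg d (2 * k - 1) < pimg d (2 * l - 1)) := by
  simp [almostSorted]

lemma mem_Hset {f : ℕ} {d : Equiv.Perm (Fin (2 * f))} :
    d ∈ Hset (2 * f) f ↔
      (∀ k, 1 ≤ k → k ≤ f → pimg d (2 * k - 1) < pimg d (2 * k)) ∧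
      (∀ k l, 1 ≤ k → k < l → l ≤ f → pimg d (2 * k - 1) < pimg d (2 * l - 1)) := by
  simp only [Hset, Finset.mem_filter, Finset.mem_univ, true_and, Finset.mem_Icc]
  constructor
  · rintro ⟨h₁, h₂, -⟩
    refine ⟨fun k hk hkf => h₂ k ⟨hk, hkf⟩, fun k l hk hkl => ?_⟩
    induction l, hkl using Nat.le_induction with
    | base => exact fun hl => h₁ k ⟨hk, by simp only [Nat.succ_eq_add_one] at hl; omega⟩
    | succ l hkl ih =>
      intro hl
      simp only [Nat.succ_eq_add_one] at hkl
      exact (ih (by omega)).trans (h₁ l ⟨by omega, by omega⟩)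
  · rintro ⟨h₁, h₂⟩
    refine ⟨fun k hk => ?_, fun k hk => h₁ k hk.1 hk.2, fun j hj => by omega⟩
    exact h₂ k (k + 1) hk.1 (by omega) (by omega)

lemma almostSorted_self (f : ℕ) : almostSorted f f = Hset (2 * f) f := by
  ext d
  rw [mem_almostSorted, mem_Hset]
  exact and_congr_right fun _ => ⟨fun h k l hk hkl hl => h k l hk hkl hl (by omega),
    fun h k l hk hkl hl _ => h k l hk hkl hl⟩

lemma bbs_mul_mem_almostSorted {f i : ℕ} (hi : 1 ≤ i) (hif : i < f)
    {w : Equiv.Perm (Fin (2 * f))} :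
    bbs (2 * f) i * w ∈ almostSorted f (i + 1) ↔
      w ∈ almostSorted f i ∧ pimg w (2 * i + 1) < pimg w (2 * i - 1) := by
  simp only [mem_almostSorted]
  have key : ∀ k, 1 ≤ k → pimg (bbs (2 * f) i * w) (2 * k - 1) =
        pimg w (2 * (if k = i then i + 1 else if k = i + 1 then i else k) - 1) ∧
      pimg (bbs (2 * f) i * w) (2 * k) =
        pimg w (2 * (if k = i then i + 1 else if k = i + 1 then i else k)) := by
    intro k hk
    rw [pimg_bbs_mul hi hif _ (by omega), pimg_bbs_mul hi hif _ (by omega)]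
    constructor <;> congr 1 <;> split_ifs <;> omega
  constructor
  · rintro ⟨h₁, h₂⟩
    have h₂' : ∀ k l, 1 ≤ k → k < l → l ≤ f → k ≠ i + 1 →
        pimg w (2 * (if k = i then i + 1 else if k = i + 1 then i else k) - 1) <
        pimg w (2 * (if l = i then i + 1 else if l = i + 1 then i else l) - 1) := by
      intro k l hk hkl hl hki
      rw [← (key k hk).1, ← (key l (by omega)).1]
      exact h₂ k l hk hkl hl hki
    refine ⟨⟨fun k hk hkf => ?_, fun k l hk hkl hl hki => ?_⟩, ?_⟩
    · have := h₁ (if k = i then i + 1 else if k = i + 1 then i else k)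
        (by split_ifs <;> omega) (by split_ifs <;> omega)
      rw [(key _ (by split_ifs <;> omega)).1, (key _ (by split_ifs <;> omega)).2] at this
      convert this using 3 <;> split_ifs <;> omega
    · by_cases h : k = i + 1
      · have := h₂' i l hi (by omega) hl (by omega)
        convert this using 3 <;> split_ifs <;> omega
      · have := h₂' k (if l = i then i + 1 else if l = i + 1 then i else l) hk
          (by split_ifs <;> omega) (by split_ifs <;> omega) h
        convert this using 3 <;> split_ifs <;> omega
    · have := h₂' i (i + 1) hi (by omega) (by omega) (by omega)
      convert this using 3 <;> split_ifs <;> omega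
  · rintro ⟨⟨h₁, h₂⟩, h₃⟩
    refine ⟨fun k hk hkf => ?_, fun k l hk hkl hl hki => ?_⟩
    · rw [(key k hk).1, (key k hk).2]
      exact h₁ _ (by split_ifs <;> omega) (by split_ifs <;> omega)
    · rw [(key k hk).1, (key l (by omega)).1]
      by_cases hkeq : k = i
      · by_cases hleq : l = i + 1
        · simpa [hkeq, hleq, mul_add] using h₃
        · simpa [hkeq, hleq, show l ≠ i by omega] using
            h₂ (i + 1) l (by omega) (by omega) hl (by omega)
      · simp only [if_neg hkeq]
        exact h₂ _ _ (by split_ifs <;> omega) (by split_ifs <;> omega) (by split_ifs <;> omega)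
          (by split_ifs <;> omega)

lemma mem_Hset_iff_mem_almostSorted {f i : ℕ} (hi : 1 ≤ i) (hif : i < f)
    {w : Equiv.Perm (Fin (2 * f))} :
    w ∈ Hset (2 * f) f ↔
      w ∈ almostSorted f i ∧ pimg w (2 * i - 1) < pimg w (2 * i + 1) := by
  rw [mem_Hset, mem_almostSorted]
  constructor
  · rintro ⟨h₁, h₂⟩
    exact ⟨⟨h₁, fun k l hk hkl hl _ => h₂ k l hk hkl hl⟩, h₂ i (i + 1) hi (by omega) (by omega)⟩
  · rintro ⟨⟨h₁, h₂⟩, h₃⟩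
    refine ⟨h₁, fun k l hk hkl hl => ?_⟩
    by_cases hki : k = i
    · subst hki
      by_cases hl' : l = k + 1
      · subst hl'
        exact h₃
      · exact h₃.trans (h₂ (k + 1) l (by omega) (by omega) hl (by omega))
    · exact h₂ k l hk hkl hl hki

open scoped Classical in
lemma almostSorted_eq_union {f i : ℕ} (hi : 1 ≤ i) (hif : i < f) :
    almostSorted f i =
      Hset (2 * f) f ∪ (almostSorted f (i + 1)).image (fun w => bbs (2 * f) i * w) := by
  ext w
  have him : w ∈ (almostSorted f (i + 1)).image (fun w => bbs (2 * f) i * w) ↔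
      bbs (2 * f) i * w ∈ almostSorted f (i + 1) := by
    rw [Finset.mem_image]
    constructor
    · rintro ⟨y, hy, rfl⟩
      rwa [bbs_mul_cancel hi hif]
    · exact fun h => ⟨_, h, bbs_mul_cancel hi hif w⟩
  rw [Finset.mem_union, him, bbs_mul_mem_almostSorted hi hif, mem_Hset_iff_mem_almostSorted hi hif,
    ← and_or_left]
  have := pimg_ne w (i := 2 * i - 1) (j := 2 * i + 1) (by omega) (by omega) (by omega) (by omega)
    (by omega)
  exact ⟨fun h => ⟨h, lt_or_gt_of_ne this⟩, And.left⟩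

open scoped Classical in
lemma disjoint_Hset_image {f i : ℕ} (hi : 1 ≤ i) (hif : i < f) :
    Disjoint (Hset (2 * f) f)
      ((almostSorted f (i + 1)).image (fun w => bbs (2 * f) i * w)) := by
  rw [Finset.disjoint_left]
  intro w hw hw'
  obtain ⟨y, hy, rfl⟩ := Finset.mem_image.1 hw'
  rw [← bbs_mul_cancel hi hif y, bbs_mul_mem_almostSorted hi hif] at hy
  exact lt_asymm ((mem_Hset_iff_mem_almostSorted hi hif).1 hw).2 hy.2

open scoped Classical in
lemma image_prod_bbs_mul_Hset {f : ℕ} (m i : ℕ) (hi : 1 ≤ i) (him : i + m = f) :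
    (Finset.range (m + 1)).image
        (fun k => ((List.range k).map (fun j => bbs (2 * f) (j + i))).prod) * Hset (2 * f) f =
      almostSorted f i := by
  induction m generalizing i with
  | zero =>
    obtain rfl : i = f := by omega
    simp [almostSorted_self, Finset.singleton_mul]
  | succ m ih =>
    rw [almostSorted_eq_union hi (by omega), ← ih (i + 1) (by omega) (by omega)]
    ext w
    simp only [Finset.mem_mul, Finset.mem_union, Finset.mem_image, Finset.mem_range]
    constructor
    · rintro ⟨_, ⟨k, hk, rfl⟩, d, hd, rfl⟩
      rcases k with _ | k
      · left
        simpa using hd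
      · right
        refine ⟨_, ⟨_, ⟨k, by omega, rfl⟩, d, hd, rfl⟩, ?_⟩
        rw [List.range_succ_eq_map, List.map_cons, List.prod_cons, List.map_map, mul_assoc,
          Nat.zero_add]
        simp only [Function.comp_def, Nat.succ_eq_add_one, add_right_comm, ← add_assoc]
    · rintro (hw | ⟨_, ⟨_, ⟨k, hk, rfl⟩, d, hd, rfl⟩, rfl⟩)
      · exact ⟨1, ⟨0, by omega, by simp⟩, w, hw, one_mul _⟩
      · refine ⟨_, ⟨k + 1, by omega, rfl⟩, d, hd, ?_⟩
        rw [List.range_succ_eq_map, List.map_cons, List.prod_cons, List.map_map, mul_assoc,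
          Nat.zero_add]
        simp only [Function.comp_def, Nat.succ_eq_add_one, add_right_comm, ← add_assoc]

/-- Permutations in `almostSorted f (i + 1)` may be rearranged on the positions
`2i, 2i+1, 2i+2`. -/
lemma mem_almostSorted_of_rearranged {f i : ℕ} (hi : 1 ≤ i) (hif : i < f)
    {w x : Equiv.Perm (Fin (2 * f))} (hw : w ∈ almostSorted f (i + 1))
    (hxw : ∀ k, 1 ≤ k → k < 2 * i ∨ 2 * i + 2 < k → pimg x k = pimg w k)
    (h₁ : pimg x (2 * i - 1) < pimg x (2 * i)) (h₂ : pimg x (2 * i - 1) < pimg x (2 * i + 1))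
    (h₃ : pimg x (2 * i + 1) < pimg x (2 * i + 2)) : x ∈ almostSorted f (i + 1) := by
  rw [mem_almostSorted] at hw ⊢
  obtain ⟨hw₁, hw₂⟩ := hw
  refine ⟨fun k hk hkf => ?_, fun k l hk hkl hl hki => ?_⟩
  · rcases eq_or_ne k i with rfl | hki
    · exact h₁
    rcases eq_or_ne k (i + 1) with rfl | hki'
    · exact h₃
    rw [hxw _ (by omega) (by omega), hxw _ (by omega) (by omega)]
    exact hw₁ k hk hkf
  · rcases eq_or_ne l (i + 1) with rfl | hli
    · refine lt_of_le_of_lt ?_ h₂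
      rcases eq_or_ne k i with rfl | hki'
      · rfl
      rw [hxw _ (by omega) (by omega), hxw _ (by omega) (by omega)]
      exact (hw₂ k i hk (by omega) (by omega) hki).le
    · rw [hxw _ (by omega) (by omega), hxw _ (by omega) (by omega)]
      exact hw₂ k l hk hkl hl hki

lemma lt_of_mem_almostSorted {f i : ℕ} (hi : 1 ≤ i) (hif : i < f)
    {w : Equiv.Perm (Fin (2 * f))} (hw : w ∈ almostSorted f (i + 1)) :
    pimg w (2 * i - 1) < pimg w (2 * i) ∧ pimg w (2 * i - 1) < pimg w (2 * i + 1) ∧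
      pimg w (2 * i + 1) < pimg w (2 * i + 2) := by
  rw [mem_almostSorted] at hw
  exact ⟨hw.1 i hi hif.le, hw.2 i (i + 1) hi (by omega) (by omega) (by omega),
    hw.1 (i + 1) (by omega) (by omega)⟩

open scoped Classical in
/-- A sum over `almostSorted f (i + 1)`, grouped by the three matchings of the four images at
`2i-1, …, 2i+2`. -/
lemma sum_almostSorted {M : Type*} [AddCommMonoid M] {f i : ℕ} (hi : 1 ≤ i) (hif : i < f)
    (φ : Equiv.Perm (Fin (2 * f)) → M) :
    ∑ w ∈ almostSorted f (i + 1), φ w =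
      ∑ y ∈ (almostSorted f (i + 1)).filter (fun y => pimg y (2 * i) < pimg y (2 * i + 1)),
        (φ y + φ (sGen (2 * f) (2 * i) * y) +
          φ (sGen (2 * f) (2 * i) * (sGen (2 * f) (2 * i + 1) * y))) := by
  have swap : ∀ (j k : ℕ) (w : Equiv.Perm (Fin (2 * f))), 1 ≤ j → j < 2 * f → 1 ≤ k →
      pimg (sGen (2 * f) j * w) k =
        pimg w (if k = j then j + 1 else if k = j + 1 then j else k) :=
    fun j k w hj hjn hk => pimg_sGen_mul hj hjn w hk
  have v₁ : ∀ (k : ℕ) (w : Equiv.Perm (Fin (2 * f))), 1 ≤ k →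
      pimg (sGen (2 * f) (2 * i) * w) k = pimg w (if k = 2 * i then 2 * i + 1 else
        if k = 2 * i + 1 then 2 * i else k) :=
    fun k w hk => swap _ _ _ (by omega) (by omega) hk
  have v₂ : ∀ (k : ℕ) (w : Equiv.Perm (Fin (2 * f))), 1 ≤ k →
      pimg (sGen (2 * f) (2 * i) * (sGen (2 * f) (2 * i + 1) * w)) k =
        pimg w (if k = 2 * i then 2 * i + 2 else if k = 2 * i + 1 then 2 * i else
          if k = 2 * i + 2 then 2 * i + 1 else k) := by
    intro k w hk
    rw [v₁ _ _ hk, swap _ _ _ (by omega) (by omega) (by split_ifs <;> omega)]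
    congr 1
    split_ifs <;> omega
  have v₃ : ∀ (k : ℕ) (w : Equiv.Perm (Fin (2 * f))), 1 ≤ k →
      pimg (sGen (2 * f) (2 * i + 1) * (sGen (2 * f) (2 * i) * w)) k =
        pimg w (if k = 2 * i then 2 * i + 1 else if k = 2 * i + 1 then 2 * i + 2 else
          if k = 2 * i + 2 then 2 * i else k) := by
    intro k w hk
    rw [swap _ _ _ (by omega) (by omega) hk, v₁ _ _ (by split_ifs <;> omega)]
    congr 1
    split_ifs <;> omega
  rw [← Finset.sum_filter_add_sum_filter_not (almostSorted f (i + 1))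
      (fun y => pimg y (2 * i) < pimg y (2 * i + 1)),
    ← Finset.sum_filter_add_sum_filter_not ((almostSorted f (i + 1)).filter
      (fun y => ¬ pimg y (2 * i) < pimg y (2 * i + 1)))
      (fun y => pimg y (2 * i) < pimg y (2 * i + 2)),
    Finset.sum_add_distrib, Finset.sum_add_distrib, add_assoc]
  simp only [Finset.filter_filter]
  congr 2
  · refine (Finset.sum_nbij' (fun y => sGen (2 * f) (2 * i) * y)
      (fun w => sGen (2 * f) (2 * i) * w) ?_ ?_ (fun y _ => sGen_mul_cancel _ y)
      (fun y _ => sGen_mul_cancel _ y) (fun _ _ => rfl)).symm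
    · intro y hy
      rw [Finset.mem_filter] at hy ⊢
      obtain ⟨hy, hlt⟩ := hy
      obtain ⟨h₁, h₂, h₃⟩ := lt_of_mem_almostSorted hi hif hy
      refine ⟨mem_almostSorted_of_rearranged hi hif hy (fun k hk hki => ?_) ?_ ?_ ?_, ?_⟩ <;>
        grind
    · intro y hy
      rw [Finset.mem_filter] at hy ⊢
      obtain ⟨hy, hlt⟩ := hy
      obtain ⟨h₁, h₂, h₃⟩ := lt_of_mem_almostSorted hi hif hy
      have hne := pimg_ne y (i := 2 * i) (j := 2 * i + 1) (by omega) (by omega) (by omega)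
        (by omega) (by omega)
      refine ⟨mem_almostSorted_of_rearranged hi hif hy (fun k hk hki => ?_) ?_ ?_ ?_, ?_⟩ <;>
        grind
  · refine (Finset.sum_nbij' (fun y => sGen (2 * f) (2 * i) * (sGen (2 * f) (2 * i + 1) * y))
      (fun w => sGen (2 * f) (2 * i + 1) * (sGen (2 * f) (2 * i) * w)) ?_ ?_ ?_ ?_
      (fun _ _ => rfl)).symm
    · intro y hy
      rw [Finset.mem_filter] at hy ⊢
      obtain ⟨hy, hlt⟩ := hy
      obtain ⟨h₁, h₂, h₃⟩ := lt_of_mem_almostSorted hi hif hy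
      refine ⟨mem_almostSorted_of_rearranged hi hif hy (fun k hk hki => ?_) ?_ ?_ ?_, ?_⟩ <;>
        grind
    · intro y hy
      rw [Finset.mem_filter] at hy ⊢
      obtain ⟨hy, hlt⟩ := hy
      obtain ⟨h₁, h₂, h₃⟩ := lt_of_mem_almostSorted hi hif hy
      have hne := pimg_ne y (i := 2 * i) (j := 2 * i + 2) (by omega) (by omega) (by omega)
        (by omega) (by omega)
      refine ⟨mem_almostSorted_of_rearranged hi hif hy (fun k hk hki => ?_) ?_ ?_ ?_, ?_⟩ <;>
        grind
    · intro y _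
      simp only [sGen_mul_cancel]
    · intro y _
      simp only [sGen_mul_cancel]

end Permutations

section Relations

variable {F : Type*} [Field F] {A : Type*} [Ring A] [Algebra F A] {n : ℕ} {q r : F}
  (D : BMWData F A n q r)

namespace BMWData

lemma E_eq {i : ℕ} (hi : 1 ≤ i) (hin : i ≤ n - 1) :
    D.E i = 1 - (q - q⁻¹)⁻¹ • (D.T i - D.Tinv i) := by
  rw [D.skein i hi hin, smul_smul, inv_mul_cancel₀ D.hqq, one_smul, sub_sub_cancel]

/-- An element intertwining `T_i` and `T_j` also intertwines `E_i` and `E_j`. -/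
lemma semiconj_E {i j : ℕ} (hi : 1 ≤ i) (hin : i ≤ n - 1) (hj : 1 ≤ j) (hjn : j ≤ n - 1) {x : A}
    (h : x * D.T i = D.T j * x) : x * D.E i = D.E j * x := by
  have hinv : x * D.Tinv i = D.Tinv j * x := by
    calc x * D.Tinv i = D.Tinv j * D.T j * x * D.Tinv i := by rw [D.Tinv_mul_T j hj hjn, one_mul]
      _ = D.Tinv j * (x * D.T i) * D.Tinv i := by rw [h, mul_assoc (D.Tinv j)]
      _ = D.Tinv j * x := by rw [mul_assoc, mul_assoc x, D.T_mul_Tinv i hi hin, mul_one]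
  rw [D.E_eq hi hin, D.E_eq hj hjn, mul_sub, sub_mul, mul_one, one_mul, mul_smul_comm,
    smul_mul_assoc, mul_sub, sub_mul, h, hinv]

lemma T_comm_E {i j : ℕ} (hi : 1 ≤ i) (hin : i ≤ n - 1) (hj : 1 ≤ j) (hjn : j ≤ n - 1)
    (hij : i + 1 < j ∨ j + 1 < i) : D.T i * D.E j = D.E j * D.T i :=
  D.semiconj_E hj hjn hj hjn (D.T_comm i j hi hin hj hjn hij)

lemma E_comm {i j : ℕ} (hi : 1 ≤ i) (hin : i ≤ n - 1) (hj : 1 ≤ j) (hjn : j ≤ n - 1)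
    (hij : i + 1 < j ∨ j + 1 < i) : D.E i * D.E j = D.E j * D.E i :=
  D.semiconj_E hj hjn hj hjn (D.T_comm_E hj hjn hi hin hij.symm).symm

lemma E_mul_T_mul_T {i : ℕ} (hi : 1 ≤ i) (hin : i + 1 ≤ n - 1) :
    D.E i * (D.T (i + 1) * D.T i) = D.E i * D.E (i + 1) := by
  rw [← D.TTE₂ i hi hin]
  exact (D.semiconj_E (by omega) hin hi (by omega)
    (by rw [← D.braid i hi hin, mul_assoc])).symm

lemma E_succ_mul_T_mul_T {i : ℕ} (hi : 1 ≤ i) (hin : i + 1 ≤ n - 1) :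
    D.E (i + 1) * (D.T i * D.T (i + 1)) = D.E (i + 1) * D.E i := by
  rw [← D.TTE₁ i hi hin]
  exact (D.semiconj_E hi (by omega) (by omega) hin
    (by rw [D.braid i hi hin, mul_assoc])).symm

lemma cap_mul_T_mul_T_left {i : ℕ} (hi : 1 ≤ i) (hin : i + 2 ≤ n - 1) :
    D.E i * D.E (i + 2) * (D.T (i + 1) * D.T i) = D.E i * D.E (i + 2) * D.E (i + 1) := by
  rw [D.E_comm hi (by omega) (by omega) hin (by omega), mul_assoc,
    D.E_mul_T_mul_T hi (by omega), mul_assoc]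

lemma cap_mul_T_mul_T_right {i : ℕ} (hi : 1 ≤ i) (hin : i + 2 ≤ n - 1) :
    D.E i * D.E (i + 2) * (D.T (i + 1) * D.T (i + 2)) = D.E i * D.E (i + 2) * D.E (i + 1) := by
  rw [mul_assoc, D.E_succ_mul_T_mul_T (i := i + 1) (by omega) hin, mul_assoc]

/-- `E_i E_{i+2}` absorbs the crossing of two adjacent caps. -/
lemma cap_mul_T_four {i : ℕ} (hi : 1 ≤ i) (hin : i + 2 ≤ n - 1) :
    D.E i * D.E (i + 2) * (D.T (i + 1) * D.T i * D.T (i + 2) * D.T (i + 1)) =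
      D.E i * D.E (i + 2) := by
  calc _ = D.E i * D.E (i + 2) * (D.T (i + 1) * D.T i) * (D.T (i + 2) * D.T (i + 1)) := by
        simp only [mul_assoc]
    _ = D.E i * D.E (i + 2) * (D.E (i + 1) * (D.T (i + 2) * D.T (i + 1))) := by
        rw [D.cap_mul_T_mul_T_left hi hin]
        simp only [mul_assoc]
    _ = D.E i * (D.E (i + 2) * D.E (i + 1) * D.E (i + 2)) := by
        rw [D.E_mul_T_mul_T (i := i + 1) (by omega) hin]
        simp only [mul_assoc]
    _ = _ := by rw [D.EEE₂ (i + 1) (by omega) hin]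

lemma cap_mul_T_three {i : ℕ} (hi : 1 ≤ i) (hin : i + 2 ≤ n - 1) :
    D.E i * D.E (i + 2) * (D.T (i + 1) * D.T i * D.T (i + 2)) =
      D.E i * D.E (i + 2) * D.Tinv (i + 1) := by
  calc _ = D.E i * D.E (i + 2) * (D.T (i + 1) * D.T i * D.T (i + 2) * D.T (i + 1)) *
        D.Tinv (i + 1) := by
        simp only [mul_assoc]
        rw [D.T_mul_Tinv (i + 1) (by omega) (by omega), mul_one]
    _ = _ := by rw [D.cap_mul_T_four hi hin]

/-- Exchanging the two caps scales the sum over the three matchings of four points by `q²`. -/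
lemma cap_mul_matching_sum {i : ℕ} (hi : 1 ≤ i) (hin : i + 2 ≤ n - 1) :
    D.E i * D.E (i + 2) * (q ^ 4 • (D.T (i + 1) * D.T i * D.T (i + 2) * D.T (i + 1)) +
        q ^ 3 • (D.T (i + 1) * D.T i * D.T (i + 2)) + q ^ 2 • (D.T (i + 1) * D.T i)) =
      q ^ 2 • (D.E i * D.E (i + 2) * (1 + q • D.T (i + 1) +
        q ^ 2 • (D.T (i + 1) * D.T (i + 2)))) := by
  have hinv : D.Tinv (i + 1) = D.T (i + 1) - (q - q⁻¹) • (1 - D.E (i + 1)) := by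
    rw [← D.skein (i + 1) (by omega) (by omega), sub_sub_cancel]
  have hq := D.hq
  simp only [mul_add, mul_smul_comm, D.cap_mul_T_four hi hin, D.cap_mul_T_three hi hin,
    D.cap_mul_T_mul_T_left hi hin, D.cap_mul_T_mul_T_right hi hin, hinv, mul_sub, mul_one]
  match_scalars <;> field_simp <;> ring

lemma Ehat_eq_mul_cap {i m : ℕ} (him : i + 2 ≤ m) (hm : 2 * m ≤ n) :
    ∃ x : A, Ehat D.E m = x * (D.E (2 * i + 1) * D.E (2 * i + 1 + 2)) := by
  have hsucc : ∀ k, Ehat D.E (k + 1) = Ehat D.E k * D.E (2 * k + 1) := fun k => by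
    simp [Ehat, List.range_succ]
  induction m, him using Nat.le_induction with
  | base => exact ⟨Ehat D.E i, by rw [hsucc, hsucc, mul_assoc]; rfl⟩
  | succ m him ih =>
    obtain ⟨x, hx⟩ := ih (by omega)
    refine ⟨x * D.E (2 * m + 1), ?_⟩
    rw [hsucc, hx, mul_assoc, mul_assoc, mul_assoc,
      D.E_comm (i := 2 * i + 1 + 2) (by omega) (by omega) (by omega) (by omega) (by omega),
      ← mul_assoc (D.E (2 * i + 1)),
      D.E_comm (i := 2 * i + 1) (by omega) (by omega) (by omega) (by omega) (by omega),
      mul_assoc]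

/-- The summand `q^{ℓ(w)} T_w` of `hat`. -/
noncomputable def weight (w : Equiv.Perm (Fin n)) : A := q ^ len w • D.Tw w

lemma weight_sGen_mul {i : ℕ} (hi : 1 ≤ i) (hin : i < n) {w : Equiv.Perm (Fin n)}
    (h : pimg w i < pimg w (i + 1)) :
    D.weight (sGen n i * w) = q • (D.T i * D.weight w) := by
  have hlen := len_sGen_mul hi hin w h
  rw [weight, weight, D.Tw_mul _ _ (by rw [hlen, len_sGen hi hin, add_comm]),
    D.Tw_s i hi (by omega), hlen, mul_smul_comm, smul_smul, pow_succ']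

/-- The window relation: for `y` increasing on `i, …, i+3`, exchanging the pairs of images at
`(i, i+1)` and `(i+2, i+3)` in the three matchings obtained from `y` scales the sum by `q²`. -/
lemma cap_mul_weight_sum {i : ℕ} (hi : 1 ≤ i) (hin : i + 3 ≤ n)
    {y : Equiv.Perm (Fin n)} (h₁ : pimg y i < pimg y (i + 1))
    (h₂ : pimg y (i + 1) < pimg y (i + 2)) (h₃ : pimg y (i + 2) < pimg y (i + 3)) :
    D.E i * D.E (i + 2) *
        (D.weight (sGen n (i + 1) * (sGen n i * (sGen n (i + 2) * (sGen n (i + 1) * y)))) +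
          D.weight (sGen n (i + 1) * (sGen n i * (sGen n (i + 2) * y))) +
          D.weight (sGen n (i + 1) * (sGen n i * y))) =
      q ^ 2 • (D.E i * D.E (i + 2) * (D.weight y + D.weight (sGen n (i + 1) * y) +
        D.weight (sGen n (i + 1) * (sGen n (i + 2) * y)))) := by
  have step : ∀ (j : ℕ) (w : Equiv.Perm (Fin n)), 1 ≤ j → j < n → pimg w j < pimg w (j + 1) →
      D.weight (sGen n j * w) = q • (D.T j * D.weight w) :=
    fun j w hj hjn h => D.weight_sGen_mul hj hjn h
  have swap : ∀ (j k : ℕ) (w : Equiv.Perm (Fin n)), 1 ≤ j → j < n → 1 ≤ k →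
      pimg (sGen n j * w) k = pimg w (if k = j then j + 1 else if k = j + 1 then j else k) :=
    fun j k w hj hjn hk => pimg_sGen_mul hj hjn w hk
  have e₁ : D.weight (sGen n (i + 1) * y) = q • (D.T (i + 1) * D.weight y) :=
    step _ _ (by omega) (by omega) h₂
  have e₂ : D.weight (sGen n (i + 2) * y) = q • (D.T (i + 2) * D.weight y) :=
    step _ _ (by omega) (by omega) h₃
  have e₀ : D.weight (sGen n i * y) = q • (D.T i * D.weight y) :=
    step _ _ (by omega) (by omega) h₁
  rw [step (i + 1) (sGen n i * (sGen n (i + 2) * (sGen n (i + 1) * y))) (by omega) (by omega)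
      (by grind),
    step i (sGen n (i + 2) * (sGen n (i + 1) * y)) (by omega) (by omega) (by grind),
    step (i + 2) (sGen n (i + 1) * y) (by omega) (by omega) (by grind), e₁,
    step (i + 1) (sGen n i * (sGen n (i + 2) * y)) (by omega) (by omega) (by grind),
    step i (sGen n (i + 2) * y) (by omega) (by omega) (by grind),
    step (i + 1) (sGen n (i + 2) * y) (by omega) (by omega) (by grind), e₂,
    step (i + 1) (sGen n i * y) (by omega) (by omega) (by grind), e₀]
  have key := congrArg (· * D.weight y) (D.cap_mul_matching_sum hi (by omega : i + 2 ≤ n - 1))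
  simp only [mul_assoc, add_mul, smul_mul_assoc, one_mul, mul_smul_comm, smul_smul] at key ⊢
  convert key using 4 <;> ring_nf

end BMWData

/-- Exchanging the `i`-th and `(i+1)`-st pairs of images scales the sum over
`almostSorted f (i + 1)` by `q²`. -/
lemma Ehat_mul_sum_bbs_mul {f : ℕ} (D : BMWData F A (2 * f) q r) {i : ℕ} (hi : 1 ≤ i)
    (hif : i < f) :
    Ehat D.E f * ∑ w ∈ almostSorted f (i + 1), D.weight (bbs (2 * f) i * w) =
      q ^ 2 • (Ehat D.E f * ∑ w ∈ almostSorted f (i + 1), D.weight w) := by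
  classical
  obtain ⟨x, hx⟩ := D.Ehat_eq_mul_cap (i := i - 1) (m := f) (by omega) le_rfl
  rw [show 2 * (i - 1) + 1 = 2 * i - 1 by omega, show 2 * i - 1 + 2 = 2 * i + 1 by omega] at hx
  rw [sum_almostSorted hi hif fun w => D.weight (bbs (2 * f) i * w),
    sum_almostSorted hi hif D.weight, hx, mul_assoc x, mul_assoc x,
    ← mul_smul_comm]
  congr 1
  rw [Finset.mul_sum, Finset.mul_sum, Finset.smul_sum]
  refine Finset.sum_congr rfl fun y hy => ?_
  rw [Finset.mem_filter] at hy
  obtain ⟨hy, h₂⟩ := hy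
  obtain ⟨h₁, -, h₃⟩ := lt_of_mem_almostSorted hi hif hy
  have key := D.cap_mul_weight_sum (i := 2 * i - 1) (y := y) (by omega) (by omega)
  rw [show 2 * i - 1 + 1 = 2 * i by omega, show 2 * i - 1 + 2 = 2 * i + 1 by omega,
    show 2 * i - 1 + 3 = 2 * i + 2 by omega] at key
  rw [← key h₁ h₂ h₃]
  simp only [bbs_mul, sGen_mul_cancel]

lemma Ehat_mul_sum_almostSorted {f : ℕ} (D : BMWData F A (2 * f) q r) (m i : ℕ) (hi : 1 ≤ i)
    (him : i + m = f) :
    Ehat D.E f * ∑ w ∈ almostSorted f i, D.weight w =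
      (∑ k ∈ Finset.range (m + 1), q ^ (2 * k)) •
        (Ehat D.E f * ∑ w ∈ Hset (2 * f) f, D.weight w) := by
  classical
  induction m generalizing i with
  | zero =>
    obtain rfl : i = f := by omega
    simp [almostSorted_self]
  | succ m ih =>
    rw [almostSorted_eq_union hi (by omega), Finset.sum_union (disjoint_Hset_image hi (by omega)),
      Finset.sum_image fun _ _ _ _ h => mul_left_cancel h, mul_add,
      Ehat_mul_sum_bbs_mul D hi (by omega), ih (i + 1) (by omega) (by omega), smul_smul,
      Finset.sum_range_succ' _ (m + 1), mul_zero, pow_zero, add_smul, one_smul, add_comm,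
      Finset.mul_sum]
    simp only [mul_add, mul_one, pow_add, mul_comm (q ^ 2)]

end Relations
/-- For `n = 2f`, `f ≥ 1`:
`Ê_f · (𝔻_{(1,f-1)}·H_f(2f))^ = (Σ_{k=0}^{f-1} q^{2k}) · Ê_f · Ĥ_f`. -/
theorem statement15 {F : Type*} [Field F] {A : Type*} [Ring A] [Algebra F A]
    {f : ℕ} (hf : 1 ≤ f) {q r : F} (D : BMWData F A (2 * f) q r) :
    Ehat D.E f * hat q D.Tw (bbD1 f * Hset (2 * f) f) =
      (∑ k ∈ Finset.range f, q ^ (2 * k)) •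
        (Ehat D.E f * hat q D.Tw (Hset (2 * f) f)) := by
  obtain ⟨m, rfl⟩ : ∃ m, f = m + 1 := ⟨f - 1, by omega⟩
  rw [bbD1, image_prod_bbs_mul_Hset m 1 le_rfl (by omega)]
  exact Ehat_mul_sum_almostSorted D m 1 le_rfl (by omega)

end BMWPaper
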